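/- For σ > 0, the integral (1/2π) ∫_ℝ e^{iρ√(2σ)} (e^{-s/ρ²} − 1) dρ, understood as an improper integral, equals Q₁(s,σ) + Q₂(s,σ), where Q₁(s,σ) = s√(σ/2) · ₀F₂(;3/2,2; sσ/2) and Q₂(s,σ) = −√(s/π) · ₀F₂(;1/2,3/2; sσ/2). -/

import Mathlib

open Filter

/-- The generalized hypergeometric function `₀F₂(;b₁,b₂;z) = ∑ z^k/((b₁)_k (b₂)_k k!)`. -/
noncomputable def hyp0F2 (b₁ b₂ z : ℝ) : ℝ :=
  ∑' k : ℕ, z ^ k /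
    ((ascPochhammer ℝ k).eval b₁ * (ascPochhammer ℝ k).eval b₂ * Nat.factorial k)

/-- `Q₁(s,σ) = s √(σ/2) ₀F₂(;3/2,2; sσ/2)`. -/
noncomputable def Q1 (s σ : ℝ) : ℝ :=
  s * Real.sqrt (σ / 2) * hyp0F2 (3 / 2) 2 (s * σ / 2)

/-- `Q₂(s,σ) = −√(s/π) ₀F₂(;1/2,3/2; sσ/2)`. -/
noncomputable def Q2 (s σ : ℝ) : ℝ :=
  -Real.sqrt (s / Real.pi) * hyp0F2 (1 / 2) (3 / 2) (s * σ / 2)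

open Filter MeasureTheory Set Topology
open scoped FourierTransform

lemma lerch_aux (k : ℝ → ℂ) (hint : IntegrableOn k (Ioi 0)) (hc : ContinuousOn k (Ioi 0))
    (h0 : ∀ n : ℕ, ∫ s in Ioi (0:ℝ), (Real.exp (-s) ^ n) • k s = 0) : ∀ s ∈ Ioi (0:ℝ), k s = 0 := by
  have hae : ∀ᵐ x ∂(volume : Measure ℝ), x ∈ Ioi (0:ℝ) → k x = 0 := by
    apply isOpen_Ioi.ae_eq_zero_of_integral_contDiff_smul_eq_zero
    · exact hint.locallyIntegrableOn
    intro g hg hgc hgs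
    have hcl : ∀ x ∉ Ioi (0:ℝ), g x = 0 := fun x hx => by
      by_contra h
      exact hx (hgs (subset_tsupport _ h))
    have e1 : ∫ x, g x • k x = ∫ x in Ioi (0:ℝ), g x • k x := by
      rw [setIntegral_eq_integral_of_forall_compl_eq_zero]
      intro x hx
      rw [hcl x hx, zero_smul]
    rw [e1]
    have hf : ContinuousOn (fun x => g (-Real.log x)) (Icc 0 1) := by
      intro x hx
      apply ContinuousAt.continuousWithinAt
      rcases eq_or_lt_of_le hx.1 with h | h
      · subst h
        have h00 : g (-Real.log 0) = 0 := by rw [Real.log_zero]; apply hcl; simp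
        have : ∀ᶠ y in 𝓝 (0:ℝ), g (-Real.log y) = 0 := by
          obtain ⟨M, hM⟩ := hgc.isCompact.isBounded.subset_closedBall 0
          have h1 : ∀ᶠ y in 𝓝[≠] (0:ℝ), Real.log y < -M :=
            Real.tendsto_log_nhdsNE_zero.eventually (eventually_lt_atBot (-M))
          rw [eventually_nhdsWithin_iff] at h1
          filter_upwards [h1] with y hy
          by_cases hy0 : y = 0
          · rw [hy0, h00]
          · have := hy hy0
            by_contra hne
            have h2 := hM (subset_tsupport _ hne)
            rw [mem_closedBall_zero_iff, Real.norm_eq_abs] at h2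
            have := le_abs_self (-Real.log y)
            linarith
        rw [ContinuousAt, h00]
        exact tendsto_const_nhds.congr' (this.mono fun y hy => hy.symm)
      · exact hg.continuous.continuousAt.comp (Real.continuousAt_log h.ne').neg
    have key : ∀ ε > 0, ‖∫ x in Ioi (0:ℝ), g x • k x‖ ≤ ε * ∫ x in Ioi (0:ℝ), ‖k x‖ := by
      intro ε hε
      obtain ⟨P, hP⟩ := exists_polynomial_near_of_continuousOn 0 1 _ hf ε hε
      have hm : ∀ n : ℕ, IntegrableOn (fun s => (Real.exp (-s) ^ n) • k s) (Ioi 0) := by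
        intro n
        refine Integrable.bdd_smul (φ := fun s : ℝ => Real.exp (-s) ^ n) hint 1 ?_ ?_
        · exact (by fun_prop : Continuous fun s : ℝ => Real.exp (-s) ^ n).aestronglyMeasurable
        · filter_upwards [ae_restrict_mem measurableSet_Ioi] with s hs
          rw [Real.norm_eq_abs, abs_of_nonneg (by positivity)]
          exact pow_le_one₀ (Real.exp_pos _).le (Real.exp_le_one_iff.2 (by simpa using le_of_lt hs))
      have hPe : ∀ s, P.eval (Real.exp (-s)) • k s =
          ∑ i ∈ P.support, P.coeff i • ((Real.exp (-s) ^ i) • k s) := by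
        intro s
        rw [Polynomial.eval_eq_sum, Polynomial.sum, Finset.sum_smul]
        simp only [mul_smul]
      have hPi : IntegrableOn (fun s => P.eval (Real.exp (-s)) • k s) (Ioi 0) := by
        simp only [hPe]
        apply integrable_finsetSum
        intro i _
        exact Integrable.smul (P.coeff i) (hm i)
      have hP0 : ∫ s in Ioi (0:ℝ), P.eval (Real.exp (-s)) • k s = 0 := by
        simp only [hPe]
        rw [integral_finsetSum]
        · apply Finset.sum_eq_zero
          intro i _
          rw [integral_smul, h0, smul_zero]
        · intro i _
          exact Integrable.smul (P.coeff i) (hm i)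
      have hgi : IntegrableOn (fun s => g s • k s) (Ioi 0) := by
        obtain ⟨C, hC⟩ := hg.continuous.bounded_above_of_compact_support hgc
        exact Integrable.bdd_smul hint C hg.continuous.aestronglyMeasurable
          (ae_of_all _ hC)
      have : ∫ x in Ioi (0:ℝ), g x • k x =
          ∫ x in Ioi (0:ℝ), (g x • k x - P.eval (Real.exp (-x)) • k x) := by
        rw [integral_sub hgi hPi, hP0, sub_zero]
      rw [this, ← integral_const_mul]
      apply norm_integral_le_of_norm_le (hint.norm.const_mul ε)
      filter_upwards [ae_restrict_mem measurableSet_Ioi] with s hs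
      rw [← sub_smul, norm_smul]
      gcongr
      have := hP (Real.exp (-s)) ⟨(Real.exp_pos _).le, Real.exp_le_one_iff.2 (by simpa using le_of_lt hs)⟩
      rw [Real.log_exp, neg_neg] at this
      rw [Real.norm_eq_abs, abs_sub_comm]
      exact this.le
    have : ‖∫ x in Ioi (0:ℝ), g x • k x‖ ≤ 0 := by
      have ht : Tendsto (fun ε : ℝ => ε * ∫ x in Ioi (0:ℝ), ‖k x‖) (𝓝[>] 0) (𝓝 (0 * ∫ x in Ioi (0:ℝ), ‖k x‖)) :=
        (tendsto_id.mul_const _).mono_left nhdsWithin_le_nhds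
      rw [zero_mul] at ht
      apply ge_of_tendsto ht
      filter_upwards [self_mem_nhdsWithin] with ε hε using key ε hε
    exact norm_le_zero_iff.1 this
  have : k =ᵐ[volume.restrict (Ioi 0)] fun _ => 0 := (ae_restrict_iff' measurableSet_Ioi).2 hae
  exact Measure.eqOn_open_of_ae_eq this isOpen_Ioi hc continuousOn_const

lemma inv_abs_int (b : ℝ) (hb : 0 < b) (w : ℝ) :
    IntegrableOn (fun v : ℝ => Complex.exp ((b - w * Complex.I) * v)) (Iic 0) ∧
    IntegrableOn (fun v : ℝ => Complex.exp ((-b - w * Complex.I) * v)) (Ioi 0) :=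
  ⟨integrableOn_exp_mul_complex_Iic (by simpa using hb) 0,
   integrableOn_exp_mul_complex_Ioi (by simpa using hb) 0⟩

lemma lorentz_pre (b : ℝ) (hb : 0 < b) (w : ℝ) :
    Integrable (fun v : ℝ => Complex.exp (-(w * v * Complex.I)) * Complex.exp (-(b * |v| : ℝ))) ∧
    ∫ v : ℝ, Complex.exp (-(w * v * Complex.I)) * Complex.exp (-(b * |v| : ℝ)) =
      (2 * b / (b ^ 2 + w ^ 2) : ℝ) := by
  obtain ⟨i1, i2⟩ := inv_abs_int b hb w
  have e1 : EqOn (fun v : ℝ => Complex.exp ((b - w * Complex.I) * v))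
    (fun v : ℝ => Complex.exp (-(w * v * Complex.I)) * Complex.exp (-(b * |v| : ℝ))) (Iic 0) := by
    intro v hv
    simp only
    rw [abs_of_nonpos hv, ← Complex.exp_add]
    push_cast; ring_nf
  have e2 : EqOn (fun v : ℝ => Complex.exp ((-b - w * Complex.I) * v))
    (fun v : ℝ => Complex.exp (-(w * v * Complex.I)) * Complex.exp (-(b * |v| : ℝ))) (Ioi 0) := by
    intro v hv
    simp only
    rw [abs_of_pos hv, ← Complex.exp_add]
    push_cast; ring_nf
  have j1 := i1.congr_fun e1 measurableSet_Iic
  have j2 := i2.congr_fun e2 measurableSet_Ioi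
  have hint := j1.union j2
  rw [Iic_union_Ioi, integrableOn_univ] at hint
  refine ⟨hint, ?_⟩
  rw [← intervalIntegral.integral_Iic_add_Ioi j1 j2, ← setIntegral_congr_fun measurableSet_Iic e1,
    ← setIntegral_congr_fun measurableSet_Ioi e2, integral_exp_mul_complex_Iic (by simpa using hb),
    integral_exp_mul_complex_Ioi (by simpa using hb)]
  have n1 : (b - w * Complex.I : ℂ) ≠ 0 := fun h => by
    have := congrArg Complex.re h; simp at this; exact hb.ne' this
  have n2 : (-b - w * Complex.I : ℂ) ≠ 0 := fun h => by
    have := congrArg Complex.re h; simp at this; exact hb.ne' this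
  have n3 : (b ^ 2 + w ^ 2 : ℂ) ≠ 0 := by
    have : (b ^ 2 + w ^ 2 : ℝ) ≠ 0 := by positivity
    exact_mod_cast this
  push_cast
  simp only [mul_zero, Complex.exp_zero]
  rw [eq_div_iff n3, div_add_div _ _ n1 n2, div_mul_eq_mul_div, div_eq_iff (mul_ne_zero n1 n2)]
  linear_combination (-2) * b * w^2 * Complex.I_sq

lemma lorentz_fourier (a q : ℝ) (ha : 0 < a) (hq : 0 < q) :
    ∫ ρ : ℝ, Complex.exp (Complex.I * ρ * a) * ((1 / (1 + q ^ 2 * ρ ^ 2) : ℝ) : ℂ) =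
      (Real.pi / q * Real.exp (-(a / q)) : ℝ) := by
  set f : ℝ → ℂ := fun v => Complex.exp (-(1 / q * |v| : ℝ)) with hf
  have hb : 0 < 1 / q := by positivity
  have hfi : Integrable f := by
    have := (lorentz_pre (1/q) hb 0).1
    simpa [hf] using this
  have hF : 𝓕 f = fun w : ℝ => ((2 * q * (1 + (2 * Real.pi * q * w) ^ 2)⁻¹ : ℝ) : ℂ) := by
    ext w
    rw [Real.fourier_real_eq_integral_exp_smul]
    have := (lorentz_pre (1/q) hb (2 * Real.pi * w)).2
    rw [show (2 * q * (1 + (2 * Real.pi * q * w) ^ 2)⁻¹ : ℝ) = 2 * (1 / q) / ((1 / q) ^ 2 + (2 * Real.pi * w) ^ 2) by field_simp, ← this]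
    congr 1
    ext v
    rw [smul_eq_mul]
    congr 2
    push_cast; ring
  have hFi : Integrable (𝓕 f) := by
    rw [hF]
    apply Integrable.ofReal
    apply Integrable.const_mul
    have := integrable_inv_one_add_sq.comp_mul_left' (R := 2 * Real.pi * q) (by positivity)
    exact this
  have hinv := hfi.fourierInv_fourier_eq hFi (v := a) (by
    apply Continuous.continuousAt; rw [hf]; fun_prop)
  rw [Real.fourierInv_eq', hF] at hinv
  have hs := Measure.integral_comp_mul_left (fun ρ : ℝ => Complex.exp (Complex.I * ρ * a) * ((1 / (1 + q ^ 2 * ρ ^ 2) : ℝ) : ℂ)) (2 * Real.pi)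
  have : (∫ v : ℝ, Complex.exp (((2 * Real.pi * inner ℝ v a : ℝ) : ℂ) * Complex.I) • ((2 * q * (1 + (2 * Real.pi * q * v) ^ 2)⁻¹ : ℝ) : ℂ))
     = (2 * q : ℝ) * ∫ x : ℝ, (Complex.exp (Complex.I * ((2 * Real.pi * x : ℝ)) * a) * ((1 / (1 + q ^ 2 * (2 * Real.pi * x : ℝ) ^ 2) : ℝ) : ℂ)) := by
    rw [← integral_const_mul]
    congr 1
    ext v
    rw [smul_eq_mul]
    have : (((2 * Real.pi * inner ℝ v a : ℝ) : ℂ) * Complex.I) = (Complex.I * ((2 * Real.pi * v : ℝ)) * a) := by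
      simp; ring
    rw [this]
    push_cast
    ring
  rw [this, hs] at hinv
  have hpi := Real.pi_pos
  rw [abs_of_pos (by positivity), Complex.real_smul, hf] at hinv
  simp only [abs_of_pos ha] at hinv
  rw [← Complex.ofReal_neg, ← Complex.ofReal_exp] at hinv
  rw [show (Real.pi / q * Real.exp (-(a / q)) : ℝ) = (Real.pi / q) * Real.exp (-(1 / q * a)) by congr 3; ring]
  rw [Complex.ofReal_mul, ← hinv, ← mul_assoc, ← mul_assoc, ← Complex.ofReal_mul, ← Complex.ofReal_mul,
    show Real.pi / q * (2 * q) * (2 * Real.pi)⁻¹ = 1 by field_simp]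
  simp

lemma poch_lower (b : ℝ) (hb : 1 / 2 ≤ b) (k : ℕ) : (1 / 2 : ℝ) ^ k ≤ (ascPochhammer ℝ k).eval b := by
  induction k with
  | zero => simp
  | succ k ih =>
    rw [ascPochhammer_succ_eval, pow_succ]
    have : (0:ℝ) ≤ k := k.cast_nonneg
    apply mul_le_mul ih (by linarith) (by norm_num) (le_trans (by positivity) ih)

lemma poch_pos (b : ℝ) (hb : 1 / 2 ≤ b) (k : ℕ) : 0 < (ascPochhammer ℝ k).eval b :=
  lt_of_lt_of_le (by positivity) (poch_lower b hb k)

lemma hyp_bound (b₁ b₂ M z : ℝ) (h1 : 1 / 2 ≤ b₁) (h2 : 1 / 2 ≤ b₂) (hz : |z| ≤ M) (k : ℕ) :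
    ‖z ^ k / ((ascPochhammer ℝ k).eval b₁ * (ascPochhammer ℝ k).eval b₂ * Nat.factorial k)‖ ≤
      (4 * M) ^ k / Nat.factorial k := by
  have p1 := poch_lower b₁ h1 k
  have p2 := poch_lower b₂ h2 k
  have q1 := poch_pos b₁ h1 k
  have q2 := poch_pos b₂ h2 k
  have hM : 0 ≤ M := (abs_nonneg z).trans hz
  have hf : (0:ℝ) < Nat.factorial k := by positivity
  rw [norm_div, norm_pow, Real.norm_eq_abs, Real.norm_of_nonneg (by positivity)]
  have e : (4 * M) ^ k / (Nat.factorial k : ℝ) = M ^ k / ((1/2) ^ k * (1/2) ^ k * Nat.factorial k) := by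
    rw [← mul_pow, mul_pow, show (4:ℝ) = (1/2 * (1/2))⁻¹ by norm_num, inv_pow]
    field_simp
  rw [e]
  gcongr

lemma hyp_continuous (b₁ b₂ : ℝ) (h1 : 1 / 2 ≤ b₁) (h2 : 1 / 2 ≤ b₂) :
    Continuous (hyp0F2 b₁ b₂) := by
  rw [continuous_iff_continuousAt]
  intro z
  have : ContinuousOn (hyp0F2 b₁ b₂) (Metric.closedBall 0 (|z| + 1)) := by
    unfold hyp0F2
    apply continuousOn_tsum (u := fun k => (4 * (|z| + 1)) ^ k / Nat.factorial k)
    · intro k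
      fun_prop
    · exact Real.summable_pow_div_factorial _
    · intro k x hx
      apply hyp_bound _ _ _ _ h1 h2
      simpa using hx
  apply this.continuousAt
  apply Metric.closedBall_mem_nhds_of_mem
  simp

lemma laplace_series (c : ℕ → ℝ) (hc : ∀ k, 0 ≤ c k) (m r L : ℝ) (hm : 0 < m) (hr : 0 < r)
    (hL : L ≠ 0) (hs : HasSum (fun k : ℕ => c k * ((1 / r) ^ (k + m) * Real.Gamma (k + m))) L) :
    IntegrableOn (fun s => ∑' k : ℕ, c k * (s ^ (k + m - 1) * Real.exp (-(r * s)))) (Ioi 0) ∧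
    ∫ s in Ioi (0:ℝ), ∑' k : ℕ, c k * (s ^ (k + m - 1) * Real.exp (-(r * s))) = L := by
  have hi : ∀ k : ℕ, ∫ s in Ioi (0:ℝ), c k * (s ^ (k + m - 1) * Real.exp (-(r * s))) =
      c k * ((1 / r) ^ (k + m) * Real.Gamma (k + m)) := by
    intro k
    rw [integral_const_mul, Real.integral_rpow_mul_exp_neg_mul_Ioi (by positivity) hr]
  have hint : ∀ k : ℕ, IntegrableOn (fun s : ℝ => c k * (s ^ (k + m - 1) * Real.exp (-(r * s)))) (Ioi 0) := by
    intro k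
    apply Integrable.const_mul
    apply Integrable.of_integral_ne_zero
    rw [Real.integral_rpow_mul_exp_neg_mul_Ioi (by positivity) hr]
    have := Real.Gamma_pos_of_pos (s := k + m) (by positivity)
    positivity
  have h := hasSum_integral_of_summable_integral_norm (μ := volume.restrict (Ioi 0)) hint (by
    apply hs.summable.congr
    intro k
    rw [← hi k]
    apply setIntegral_congr_fun measurableSet_Ioi
    intro s hs
    have : (0:ℝ) < s := hs
    have := hc k
    simp only
    rw [Real.norm_of_nonneg (by positivity)])
  have he : ∫ s in Ioi (0:ℝ), ∑' k : ℕ, c k * (s ^ (k + m - 1) * Real.exp (-(r * s))) = L := by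
    apply h.unique
    simpa only [hi] using hs
  refine ⟨?_, he⟩
  apply Integrable.of_integral_ne_zero
  rw [he]; exact hL

lemma poch_two (k : ℕ) : (ascPochhammer ℝ k).eval 2 = Nat.factorial (k + 1) := by
  induction k with
  | zero => simp
  | succ k ih => rw [ascPochhammer_succ_eval, ih, Nat.factorial_succ (k+1)]; push_cast; ring

lemma poch_half (k : ℕ) : (ascPochhammer ℝ k).eval (1/2) * Nat.factorial k * 4 ^ k = Nat.factorial (2 * k) := by
  induction k with
  | zero => simp
  | succ k ih =>
    rw [ascPochhammer_succ_eval, show 2 * (k + 1) = (2 * k + 1) + 1 by ring, Nat.factorial_succ (2*k+1),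
      Nat.factorial_succ (2*k), Nat.factorial_succ k]
    push_cast; rw [← ih]; ring

lemma poch_three_half (k : ℕ) : (ascPochhammer ℝ k).eval (3/2) * Nat.factorial k * 4 ^ k = Nat.factorial (2 * k + 1) := by
  induction k with
  | zero => simp
  | succ k ih =>
    rw [ascPochhammer_succ_eval, show 2 * (k + 1) + 1 = (2 * k + 1) + 1 + 1 by ring, Nat.factorial_succ (2*k+1+1),
      Nat.factorial_succ (2*k+1), Nat.factorial_succ k]
    push_cast; rw [← ih]; ring

lemma gamma_three_half (k : ℕ) : Real.Gamma (k + 3 / 2) = (ascPochhammer ℝ k).eval (3/2) * (Real.sqrt Real.pi / 2) := by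
  induction k with
  | zero =>
    rw [Nat.cast_zero, zero_add, show (3/2 : ℝ) = 1/2 + 1 by norm_num, Real.Gamma_add_one (by norm_num), Real.Gamma_one_half_eq]
    simp; ring
  | succ k ih =>
    rw [ascPochhammer_succ_eval, show ((k + 1 : ℕ) : ℝ) + 3/2 = (k + 3/2) + 1 by push_cast; ring,
      Real.Gamma_add_one (by positivity), ih]
    ring

lemma laplace_Q1 (a q : ℝ) (ha : 0 < a) (hq : 0 < q) :
    IntegrableOn (fun s => Q1 s (a ^ 2 / 2) * Real.exp (-(q ^ 2 * s))) (Ioi 0) ∧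
    ∫ s in Ioi (0:ℝ), Q1 s (a ^ 2 / 2) * Real.exp (-(q ^ 2 * s)) = 1 / (2 * q ^ 3) * Real.sinh (a / q) := by
  have hsinh : 0 < Real.sinh (a / q) := Real.sinh_pos_iff.2 (by positivity)
  have h := laplace_series (fun k => a / 2 * ((a ^ 2 / 4) ^ k / ((ascPochhammer ℝ k).eval (3/2) * (ascPochhammer ℝ k).eval 2 * Nat.factorial k)))
    (fun k => by
      have := poch_pos (3/2) (by norm_num) k
      have := poch_pos 2 (by norm_num) k
      positivity) 2 (q ^ 2) (1 / (2 * q ^ 3) * Real.sinh (a / q)) (by norm_num) (by positivity) (by positivity)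
    (by
      refine ((Real.hasSum_sinh (a / q)).mul_left (1 / (2 * q ^ 3))).congr_fun ?_
      intro k
      rw [poch_two, ← poch_three_half, show (k : ℝ) + 2 = ((k + 1 : ℕ) : ℝ) + 1 by push_cast; ring, Real.Gamma_nat_eq_factorial,
        show ((k + 1 : ℕ) : ℝ) + 1 = ((k + 2 : ℕ) : ℝ) by push_cast; ring, Real.rpow_natCast]
      have := poch_pos (3/2) (by norm_num) k
      rw [div_pow a q, div_pow _ (4:ℝ), one_div, inv_pow, ← pow_mul, ← pow_mul, pow_succ a]
      field_simp
      ring)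
  have e : EqOn (fun s => ∑' k : ℕ, a / 2 * ((a ^ 2 / 4) ^ k / ((ascPochhammer ℝ k).eval (3/2) * (ascPochhammer ℝ k).eval 2 * Nat.factorial k)) * (s ^ ((k:ℝ) + 2 - 1) * Real.exp (-(q ^ 2 * s))))
      (fun s => Q1 s (a ^ 2 / 2) * Real.exp (-(q ^ 2 * s))) (Ioi 0) := by
    intro s hs
    have hs : 0 < s := hs
    simp only
    rw [Q1, hyp0F2, show a ^ 2 / 2 / 2 = (a / 2) ^ 2 by ring, Real.sqrt_sq (by positivity),
      ← tsum_mul_left, ← tsum_mul_right]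
    congr 1
    ext k
    rw [show (k : ℝ) + 2 - 1 = ((k + 1 : ℕ) : ℝ) by push_cast; ring, Real.rpow_natCast,
      show s * (a ^ 2 / 2) / 2 = s * (a ^ 2 / 4) by ring, mul_pow]
    ring
  exact ⟨h.1.congr_fun e measurableSet_Ioi, by rw [← setIntegral_congr_fun measurableSet_Ioi e]; exact h.2⟩

lemma laplace_Q2 (a q : ℝ) (ha : 0 < a) (hq : 0 < q) :
    IntegrableOn (fun s => Q2 s (a ^ 2 / 2) * Real.exp (-(q ^ 2 * s))) (Ioi 0) ∧
    ∫ s in Ioi (0:ℝ), Q2 s (a ^ 2 / 2) * Real.exp (-(q ^ 2 * s)) = -(1 / (2 * q ^ 3) * Real.cosh (a / q)) := by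
  have hcosh : 0 < Real.cosh (a / q) := Real.cosh_pos _
  have hpi : 0 < Real.sqrt Real.pi := Real.sqrt_pos.2 Real.pi_pos
  have h := laplace_series (fun k => 1 / Real.sqrt Real.pi * ((a ^ 2 / 4) ^ k / ((ascPochhammer ℝ k).eval (1/2) * (ascPochhammer ℝ k).eval (3/2) * Nat.factorial k)))
    (fun k => by
      have := poch_pos (3/2) (by norm_num) k
      have := poch_pos (1/2) (by norm_num) k
      positivity) (3/2) (q ^ 2) (1 / (2 * q ^ 3) * Real.cosh (a / q)) (by norm_num) (by positivity) (by positivity)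
    (by
      refine ((Real.hasSum_cosh (a / q)).mul_left (1 / (2 * q ^ 3))).congr_fun ?_
      intro k
      have e1 : (1 / q ^ 2) ^ ((k : ℝ) + 3/2) = 1 / q ^ (2 * k + 3) := by
        rw [show 1 / q ^ 2 = (1/q) ^ (2:ℝ) by rw [Real.rpow_two]; ring, ← Real.rpow_mul (by positivity),
          show (2:ℝ) * (k + 3/2) = ((2 * k + 3 : ℕ) : ℝ) by push_cast; ring, Real.rpow_natCast]
        ring
      rw [gamma_three_half, ← poch_half, e1]
      have := poch_pos (3/2) (by norm_num) k
      have := poch_pos (1/2) (by norm_num) k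
      rw [div_pow a q, div_pow _ (4:ℝ), ← pow_mul]
      field_simp
      ring)
  have e : EqOn (fun s => -∑' k : ℕ, 1 / Real.sqrt Real.pi * ((a ^ 2 / 4) ^ k / ((ascPochhammer ℝ k).eval (1/2) * (ascPochhammer ℝ k).eval (3/2) * Nat.factorial k)) * (s ^ ((k:ℝ) + 3/2 - 1) * Real.exp (-(q ^ 2 * s))))
      (fun s => Q2 s (a ^ 2 / 2) * Real.exp (-(q ^ 2 * s))) (Ioi 0) := by
    intro s hs
    have hs : 0 < s := hs
    simp only
    rw [Q2, hyp0F2, neg_mul, neg_mul, ← tsum_mul_left, ← tsum_mul_right]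
    congr 2
    ext k
    rw [show (k : ℝ) + 3/2 - 1 = k + 1/2 by ring, Real.rpow_add hs, Real.rpow_natCast, ← Real.sqrt_eq_rpow,
      show s * (a ^ 2 / 2) / 2 = s * (a ^ 2 / 4) by ring, mul_pow, Real.sqrt_div hs.le]
    ring
  exact ⟨h.1.neg.congr_fun e measurableSet_Ioi, by rw [← setIntegral_congr_fun measurableSet_Ioi e, integral_neg, h.2]⟩

noncomputable def GG (a s ρ : ℝ) : ℂ :=
  Complex.exp (Complex.I * ρ * a) * ((Real.exp (-s / ρ ^ 2) : ℝ) - 1)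

lemma GG_bound (a s ρ : ℝ) (hs : 0 ≤ s) : ‖GG a s ρ‖ ≤ (1 + s) * (1 + ρ ^ 2)⁻¹ := by
  have e : ‖GG a s ρ‖ = |Real.exp (-s / ρ ^ 2) - 1| := by
    rw [GG, norm_mul, show Complex.I * ρ * a = ((ρ * a : ℝ) : ℂ) * Complex.I by push_cast; ring,
      Complex.norm_exp_ofReal_mul_I, one_mul, ← Complex.ofReal_one, ← Complex.ofReal_sub, Complex.norm_real,
      Real.norm_eq_abs]
  have h0 : -s / ρ ^ 2 ≤ 0 := div_nonpos_of_nonpos_of_nonneg (by linarith) (by positivity)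
  have h1 : Real.exp (-s / ρ ^ 2) ≤ 1 := Real.exp_le_one_iff.2 h0
  rw [e, abs_of_nonpos (by linarith), ← div_eq_mul_inv, le_div_iff₀ (by positivity)]
  have h2 := Real.add_one_le_exp (-s / ρ ^ 2)
  have h3 := Real.exp_pos (-s / ρ ^ 2)
  rcases le_total (ρ ^ 2) s with h | h
  · nlinarith [sq_nonneg ρ]
  · rcases eq_or_lt_of_le (sq_nonneg ρ) with h4 | h4
    · rw [← h4]; simp; linarith
    · have h5 : -s / ρ ^ 2 * ρ ^ 2 = -s := div_mul_cancel₀ _ h4.ne'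
      have h6 : -(Real.exp (-s / ρ ^ 2) - 1) ≤ -(-s / ρ ^ 2) := by linarith
      have h7 : -(-s / ρ ^ 2) ≤ 1 := by
        rw [neg_div, neg_neg]; exact div_le_one_of_le₀ h h4.le
      nlinarith

lemma GG_meas (a : ℝ) : Measurable (fun p : ℝ × ℝ => GG a p.1 p.2) := by
  unfold GG; fun_prop

lemma GG_integrable (a s : ℝ) (hs : 0 ≤ s) : Integrable (GG a s) := by
  refine Integrable.mono' (integrable_inv_one_add_sq.const_mul (1 + s)) ?_ (ae_of_all _ fun ρ => GG_bound a s ρ hs)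
  exact ((GG_meas a).comp (measurable_prodMk_left (x := s))).aestronglyMeasurable

noncomputable def FF (a s : ℝ) : ℂ := ∫ ρ, GG a s ρ

lemma FF_continuousOn (a : ℝ) : ContinuousOn (FF a) (Ioi 0) := by
  intro s hs
  have hs : 0 < s := hs
  apply ContinuousAt.continuousWithinAt
  unfold FF
  apply continuousAt_of_dominated (bound := fun ρ => (1 + (s + 1)) * (1 + ρ ^ 2)⁻¹)
  · exact Eventually.of_forall fun t => ((GG_meas a).comp (measurable_prodMk_left (x := t))).aestronglyMeasurable
  · filter_upwards [Ioo_mem_nhds hs (lt_add_one s)] with t ht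
    refine ae_of_all _ fun ρ => (GG_bound a t ρ ht.1.le).trans ?_
    have := ht.2
    gcongr
  · exact integrable_inv_one_add_sq.const_mul _
  · refine ae_of_all _ fun ρ => ?_
    unfold GG
    fun_prop

lemma exp_one_add_int (r : ℝ) (hr : 0 < r) :
    IntegrableOn (fun s : ℝ => Real.exp (-(r * s)) * (1 + s)) (Ioi 0) := by
  have h1 : IntegrableOn (fun s : ℝ => s ^ ((1:ℝ) - 1) * Real.exp (-(r * s))) (Ioi 0) := by
    apply Integrable.of_integral_ne_zero
    rw [Real.integral_rpow_mul_exp_neg_mul_Ioi (by norm_num) hr]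
    have := Real.Gamma_pos_of_pos (s := 1) (by norm_num)
    positivity
  have h2 : IntegrableOn (fun s : ℝ => s ^ ((2:ℝ) - 1) * Real.exp (-(r * s))) (Ioi 0) := by
    apply Integrable.of_integral_ne_zero
    rw [Real.integral_rpow_mul_exp_neg_mul_Ioi (by norm_num) hr]
    have := Real.Gamma_pos_of_pos (s := 2) (by norm_num)
    positivity
  refine (h1.add h2).congr_fun ?_ measurableSet_Ioi
  intro s hs
  simp only [Pi.add_apply]
  norm_num
  ring

lemma laplace_FF (a q : ℝ) (ha : 0 < a) (hq : 0 < q) :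
    IntegrableOn (fun s : ℝ => (Real.exp (-(q ^ 2 * s)) : ℂ) * FF a s) (Ioi 0) ∧
    ∫ s in Ioi (0:ℝ), (Real.exp (-(q ^ 2 * s)) : ℂ) * FF a s =
      ((-(Real.pi / q ^ 3 * Real.exp (-(a / q))) : ℝ) : ℂ) := by
  have hprod : Integrable (fun p : ℝ × ℝ => (Real.exp (-(q ^ 2 * p.1)) : ℂ) * GG a p.1 p.2)
      ((volume.restrict (Ioi 0)).prod volume) := by
    refine Integrable.mono' ((exp_one_add_int (q ^ 2) (by positivity)).mul_prod integrable_inv_one_add_sq) ?_ ?_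
    · apply Measurable.aestronglyMeasurable
      have := GG_meas a
      fun_prop
    · have : ∀ᵐ p : ℝ × ℝ ∂((volume.restrict (Ioi 0)).prod volume), p.1 ∈ Ioi (0:ℝ) := by
        have := Measure.quasiMeasurePreserving_fst (μ := volume.restrict (Ioi (0:ℝ))) (ν := (volume : Measure ℝ))
        exact this.ae (ae_restrict_mem measurableSet_Ioi)
      filter_upwards [this] with p hp
      rw [norm_mul, Complex.norm_real, Real.norm_of_nonneg (Real.exp_pos _).le, mul_assoc]
      gcongr
      exact GG_bound a _ _ (le_of_lt hp)
  have hF : ∀ s, (Real.exp (-(q ^ 2 * s)) : ℂ) * FF a s = ∫ ρ, (Real.exp (-(q ^ 2 * s)) : ℂ) * GG a s ρ := by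
    intro s; rw [FF, integral_const_mul]
  simp only [hF]
  refine ⟨hprod.integral_prod_left, ?_⟩
  rw [integral_integral_swap hprod]
  have hin : ∀ ρ : ℝ, ρ ≠ 0 → ∫ s in Ioi (0:ℝ), (Real.exp (-(q ^ 2 * s)) : ℂ) * GG a s ρ =
      ((-(1 / q ^ 2) : ℝ) : ℂ) * (Complex.exp (Complex.I * ρ * a) * ((1 / (1 + q ^ 2 * ρ ^ 2) : ℝ) : ℂ)) := by
    intro ρ hρ
    have hρ2 : 0 < ρ ^ 2 := by positivity
    have e : ∀ s : ℝ, (Real.exp (-(q ^ 2 * s)) : ℂ) * GG a s ρ = Complex.exp (Complex.I * ρ * a) *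
        ((Real.exp (-(q ^ 2 + 1 / ρ ^ 2) * s) - Real.exp (-q ^ 2 * s) : ℝ) : ℂ) := by
      intro s
      rw [GG, show -(q ^ 2 + 1 / ρ ^ 2) * s = -(q ^ 2 * s) + -s / ρ ^ 2 by ring, Real.exp_add,
        show -q ^ 2 * s = -(q ^ 2 * s) by ring]
      push_cast; ring
    simp only [e]
    have hn1 : -(q ^ 2 + 1 / ρ ^ 2) < 0 := by
      have : 0 < q ^ 2 + 1 / ρ ^ 2 := by positivity
      linarith
    have hn2 : -q ^ 2 < 0 := by
      have : 0 < q ^ 2 := by positivity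
      linarith
    rw [integral_const_mul, integral_complex_ofReal, integral_sub (integrableOn_exp_mul_Ioi hn1 0) (integrableOn_exp_mul_Ioi hn2 0),
      integral_exp_mul_Ioi hn1, integral_exp_mul_Ioi hn2, mul_left_comm, ← Complex.ofReal_mul]
    congr 2
    simp only [mul_zero, Real.exp_zero]
    field_simp
    ring
  have hne : ∀ᵐ ρ : ℝ, ρ ≠ 0 := by
    simp [ae_iff]
  rw [integral_congr_ae (hne.mono hin), integral_const_mul, lorentz_fourier a q ha hq, ← Complex.ofReal_mul]
  congr 1
  field_simp

lemma FF_eq (a s : ℝ) (ha : 0 < a) (hs : 0 < s) :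
    FF a s = ((2 * Real.pi * (Q1 s (a ^ 2 / 2) + Q2 s (a ^ 2 / 2)) : ℝ) : ℂ) := by
  set D : ℝ → ℂ := fun s => FF a s - ((2 * Real.pi * (Q1 s (a ^ 2 / 2) + Q2 s (a ^ 2 / 2)) : ℝ) : ℂ) with hD
  have hL : ∀ q : ℝ, 0 < q → IntegrableOn (fun s : ℝ => (Real.exp (-(q ^ 2 * s)) : ℂ) * D s) (Ioi 0) ∧
      ∫ s in Ioi (0:ℝ), (Real.exp (-(q ^ 2 * s)) : ℂ) * D s = 0 := by
    intro q hq
    obtain ⟨f1, f2⟩ := laplace_FF a q ha hq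
    obtain ⟨g1, g2⟩ := laplace_Q1 a q ha hq
    obtain ⟨h1, h2⟩ := laplace_Q2 a q ha hq
    have hQ : Integrable (fun s : ℝ => ((2 * Real.pi * (Q1 s (a ^ 2 / 2) * Real.exp (-(q ^ 2 * s)) +
        Q2 s (a ^ 2 / 2) * Real.exp (-(q ^ 2 * s))) : ℝ) : ℂ)) (volume.restrict (Ioi 0)) :=
      ((g1.add h1).const_mul (2 * Real.pi)).ofReal (𝕜 := ℂ)
    have e : (fun s : ℝ => (Real.exp (-(q ^ 2 * s)) : ℂ) * D s) = fun s : ℝ =>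
        (Real.exp (-(q ^ 2 * s)) : ℂ) * FF a s - ((2 * Real.pi * (Q1 s (a ^ 2 / 2) * Real.exp (-(q ^ 2 * s)) + Q2 s (a ^ 2 / 2) * Real.exp (-(q ^ 2 * s))) : ℝ) : ℂ) := by
      ext s
      rw [hD]; push_cast; ring
    rw [e]
    refine ⟨f1.sub hQ, ?_⟩
    rw [integral_sub f1 hQ, f2, integral_complex_ofReal, integral_const_mul, integral_add g1 h1, g2, h2, ← Complex.ofReal_sub,
      Complex.ofReal_eq_zero, ← Real.cosh_sub_sinh]
    field_simp
    ring
  have hDc : ContinuousOn D (Ioi 0) := by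
    apply (FF_continuousOn a).sub
    apply Continuous.continuousOn
    have c1 := hyp_continuous (3/2) 2 (by norm_num) (by norm_num)
    have c2 := hyp_continuous (1/2) (3/2) (by norm_num) (by norm_num)
    unfold Q1 Q2
    fun_prop
  have := lerch_aux (fun s : ℝ => (Real.exp (-(1 ^ 2 * s)) : ℂ) * D s) (hL 1 one_pos).1
    (ContinuousOn.mul (by fun_prop) hDc) (by
      intro n
      have h := (hL (Real.sqrt (n + 1)) (by positivity)).2
      rw [← h]
      congr 1
      ext s
      rw [Real.sq_sqrt (by positivity), Complex.real_smul, ← mul_assoc, ← Complex.ofReal_mul, ← Real.exp_nat_mul, ← Real.exp_add]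
      congr 3
      ring_nf) s hs
  simp only [mul_eq_zero, Complex.ofReal_eq_zero, (Real.exp_pos _).ne', false_or] at this
  exact sub_eq_zero.1 this

/-- For `σ > 0`, `s ≥ 0`, the improper integral
`(1/2π) ∫_ℝ e^{iρ√(2σ)} (e^{-s/ρ²} − 1) dρ` equals `Q₁(s,σ) + Q₂(s,σ)`. -/
theorem improper_fourier_integral_eq_Q (σ s : ℝ) (hσ : 0 < σ) (hs : 0 ≤ s) :
    Tendsto (fun R : ℝ => (1 / (2 * Real.pi) : ℂ) * ∫ ρ in (-R : ℝ)..R,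
        Complex.exp (Complex.I * ρ * Real.sqrt (2 * σ)) *
          ((Real.exp (-s / ρ ^ 2) : ℝ) - 1))
      atTop (nhds ((Q1 s σ + Q2 s σ : ℝ) : ℂ)) := by
  have ha : 0 < Real.sqrt (2 * σ) := by positivity
  have hint := GG_integrable (Real.sqrt (2 * σ)) s hs
  have ht := (intervalIntegral_tendsto_integral hint tendsto_neg_atTop_atBot tendsto_id).const_mul (1 / (2 * Real.pi) : ℂ)
  have hval : (1 / (2 * Real.pi) : ℂ) * ∫ ρ, GG (Real.sqrt (2 * σ)) s ρ = ((Q1 s σ + Q2 s σ : ℝ) : ℂ) := by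
    rcases eq_or_lt_of_le hs with h | h
    · subst h
      simp [GG, Q1, Q2]
    · have := FF_eq _ s ha h
      rw [FF] at this
      rw [this, Real.sq_sqrt (by positivity), show 2 * σ / 2 = σ by ring]
      have : (Real.pi : ℂ) ≠ 0 := by exact_mod_cast Real.pi_ne_zero
      push_cast
      field_simp
  rw [hval] at ht
  exact ht
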